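/- arXiv:1803.08759 — 9 statements merged into one kernel-verified Lean document; each statement's English description precedes it below -/
import Mathlib

section
/- Let Γ = (V, E) be a finite connected simple graph and B ⊆ V a boundary set with |B| = b ≥ 2 such that no edge of Γ joins two vertices of B, and let d_B denote the maximum graph distance in Γ between two vertices of B. Then every function v : V → ℝ satisfying ∑_{i∈B} v_i = 0 and ∑_{i∈B} v_i² = 1 has Dirichlet energy ∑_{{i,j}∈E} (v_i − v_j)² ≥ b/((b−1)²·d_B). Equivalently, the first nonzero Steklov eigenvalue σ₁ of (Γ, B) satisfies σ₁ ≥ b/((b−1)²·d_B). -/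
open Finset

theorem walk_energy_aux {V : Type*} (G : SimpleGraph V) (v : V → ℝ) (f : Sym2 V → ℝ)
    (hf : ∀ i j, f s(i, j) = (v i - v j) ^ 2) {x y : V} (w : G.Walk x y) :
    0 ≤ (w.edges.map f).sum ∧ (v x - v y) ^ 2 ≤ (w.length : ℝ) * (w.edges.map f).sum := by
  induction w with
  | nil => simp
  | @cons a c d h p ih =>
    obtain ⟨h0, h1⟩ := ih
    simp only [SimpleGraph.Walk.edges_cons, List.map_cons, List.sum_cons,
      SimpleGraph.Walk.length_cons, hf]
    push_cast
    set S := (p.edges.map f).sum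
    have hn : (0 : ℝ) ≤ p.length := by positivity
    set n : ℝ := (p.length : ℝ)
    refine ⟨by positivity, ?_⟩
    have key : 2 * (v a - v c) * (v c - v d) ≤ n * (v a - v c) ^ 2 + S := by
      apply le_of_abs_le
      apply abs_le_of_sq_le_sq
      nlinarith [sq_nonneg (n * (v a - v c) ^ 2 - S),
        mul_le_mul_of_nonneg_left h1 (sq_nonneg (v a - v c))]
      positivity
    nlinarith

/-- **Theorem 1 (Perrin, lower bound for σ₁, I).**
For a finite connected simple graph `G` with boundary set `B` (no edge joins two
boundary vertices), `|B| = b ≥ 2`, and boundary diameter `dB`, every function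
`v : V → ℝ` with `∑_{i ∈ B} v i = 0` and `∑_{i ∈ B} (v i)² = 1` has Dirichlet
energy at least `b / ((b-1)² · dB)`; equivalently `σ₁ ≥ b / ((b-1)² · dB)`. -/
theorem steklov_lower_bound_I {V : Type*} [Fintype V] [DecidableEq V]
    (G : SimpleGraph V) [DecidableRel G.Adj] (hconn : G.Connected)
    (B : Finset V) (b : ℕ) (hb : B.card = b) (hb2 : 2 ≤ b)
    (hBedge : ∀ i ∈ B, ∀ j ∈ B, ¬ G.Adj i j)
    (dB : ℕ) (hdB : dB = (B ×ˢ B).sup fun p => G.dist p.1 p.2)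
    (v : V → ℝ) (hsum : ∑ i ∈ B, v i = 0) (hnorm : ∑ i ∈ B, (v i) ^ 2 = 1) :
    (b : ℝ) / (((b : ℝ) - 1) ^ 2 * dB) ≤
      ∑ e ∈ G.edgeFinset,
        Sym2.lift ⟨fun i j => (v i - v j) ^ 2, fun i j => by ring⟩ e := by
  obtain ⟨f, hfdef⟩ : ∃ f : Sym2 V → ℝ, f = Sym2.lift
    ⟨fun i j => (v i - v j) ^ 2, fun i j => by ring⟩ := ⟨_, rfl⟩
  rw [← hfdef]
  have hf : ∀ i j, f s(i, j) = (v i - v j) ^ 2 := by intro i j; rw [hfdef]; rfl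
  have hf0 : ∀ e, 0 ≤ f e := by
    intro e
    induction e using Sym2.ind with
    | _ i j => rw [hf]; positivity
  have hne : B.Nonempty := by rw [← Finset.card_pos]; omega
  obtain ⟨p, hp, hpm⟩ := B.exists_max_image v hne
  obtain ⟨q, hq, hqm⟩ := B.exists_min_image v hne
  obtain ⟨w, hw, hlen⟩ := hconn.exists_path_of_dist p q
  have hd : G.dist p q ≤ dB := by
    rw [hdB]
    exact Finset.le_sup (f := fun r : V × V => G.dist r.1 r.2)
      (Finset.mk_mem_product hp hq)
  obtain ⟨h0, h1⟩ := walk_energy_aux G v f hf w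
  have hle : (w.edges.map f).sum ≤ ∑ e ∈ G.edgeFinset, f e := by
    rw [← List.sum_toFinset f hw.isTrail.edges_nodup]
    apply Finset.sum_le_sum_of_subset_of_nonneg
    · intro e he
      rw [SimpleGraph.mem_edgeFinset]
      exact w.edges_subset_edgeSet (List.mem_toFinset.1 he)
    · intro e _ _; exact hf0 e
  have hpop : (0 : ℝ) ≤ ∑ i ∈ B, (v p - v i) * (v i - v q) :=
    Finset.sum_nonneg fun i hi =>
      mul_nonneg (sub_nonneg.2 (hpm i hi)) (sub_nonneg.2 (hqm i hi))
  have heq : ∑ i ∈ B, (v p - v i) * (v i - v q) = -(b * (v p * v q)) - 1 := by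
    have : ∀ i ∈ B, (v p - v i) * (v i - v q) =
        (v p + v q) * v i - v i ^ 2 - v p * v q := by intro i _; ring
    rw [Finset.sum_congr rfl this, Finset.sum_sub_distrib, Finset.sum_sub_distrib,
      ← Finset.mul_sum, hsum, hnorm, Finset.sum_const, hb, nsmul_eq_mul]
    ring
  rw [heq] at hpop
  set E := ∑ e ∈ G.edgeFinset, f e
  have hb' : (2 : ℝ) ≤ b := by exact_mod_cast hb2
  have hE0 : 0 ≤ E := h0.trans hle
  have h2 : (v p - v q) ^ 2 ≤ dB * E := by
    refine h1.trans (mul_le_mul ?_ hle h0 (by positivity))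
    rw [hlen]; exact_mod_cast hd
  have h3 : 4 ≤ (b : ℝ) * (dB * E) := by
    have h4 := mul_le_mul_of_nonneg_left h2 (by linarith : (0 : ℝ) ≤ b)
    have h5 := mul_nonneg (by linarith : (0 : ℝ) ≤ b) (sq_nonneg (v p + v q))
    nlinarith
  have hdE : (0 : ℝ) ≤ dB * E := by positivity
  rcases Nat.eq_zero_or_pos dB with hz | hpos
  · rw [hz]; simpa using hE0
  have hpos' : (0 : ℝ) < dB := by exact_mod_cast hpos
  have hb1 : (0 : ℝ) < (b : ℝ) - 1 := by linarith
  rw [div_le_iff₀ (by positivity)]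
  have h6 : (b : ℝ) ^ 2 ≤ 4 * ((b : ℝ) - 1) ^ 2 := by nlinarith
  have h7 := mul_le_mul_of_nonneg_right h6 hdE
  have h8 := mul_le_mul_of_nonneg_left h3 (by linarith : (0 : ℝ) ≤ b)
  nlinarith
end

section
/- Let Γ = (V, E) be a finite connected simple graph and B ⊆ V a boundary set with |B| = b ≥ 2 such that no edge of Γ joins two vertices of B, and let d_B denote the maximum graph distance in Γ between two vertices of B. Then every function v : V → ℝ satisfying ∑_{i∈B} v_i = 0 and ∑_{i∈B} v_i² = 1 has Dirichlet energy ∑_{{i,j}∈E} (v_i − v_j)² ≥ b/(⌊b/2⌋·⌈b/2⌉·d_B). Equivalently, the first nonzero Steklov eigenvalue σ₁ of (Γ, B) satisfies σ₁ ≥ b/(⌊b/2⌋·⌈b/2⌉·d_B). -/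
open Finset

lemma walk_energy {V : Type*} (G : SimpleGraph V) (v : V → ℝ) (f : Sym2 V → ℝ)
    (hf : ∀ i j, f s(i, j) = (v i - v j) ^ 2) {u w : V} (p : G.Walk u w) :
    (v u - v w) ^ 2 ≤ p.length * (p.edges.map f).sum := by
  induction p with
  | nil => simp
  | @cons a x c h p ih =>
    simp only [SimpleGraph.Walk.length_cons, SimpleGraph.Walk.edges_cons, List.map_cons,
      List.sum_cons, hf]
    push_cast
    have hS : 0 ≤ (p.edges.map f).sum := by
      apply List.sum_nonneg
      intro y hy
      obtain ⟨e, -, rfl⟩ := List.mem_map.1 hy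
      induction e with
      | h i j => rw [hf]; positivity
    generalize (p.edges.map f).sum = S at *
    rcases Nat.eq_zero_or_pos p.length with h0 | h0
    · rw [h0] at ih ⊢
      have : v x - v c = 0 := by
        have : (v x - v c) ^ 2 ≤ 0 := by simpa using ih
        exact pow_eq_zero_iff (two_ne_zero) |>.1 (le_antisymm this (sq_nonneg _))
      have : v x = v c := by linarith
      rw [this]; simp; linarith
    · have hn : (0 : ℝ) < p.length := by exact_mod_cast h0
      generalize (p.length : ℝ) = n at *
      have key : 0 ≤ n * (S + n * (v a - v x) ^ 2 - 2 * (v a - v x) * (v x - v c)) := by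
        nlinarith [sq_nonneg (n * (v a - v x) - (v x - v c))]
      have := nonneg_of_mul_nonneg_right key hn
      nlinarith

lemma nat_split (b k : ℕ) (hk : k ≤ b) :
    (k : ℝ) * (b - k) ≤ (b / 2 : ℕ) * ((b + 1) / 2 : ℕ) := by
  obtain ⟨l, rfl⟩ := Nat.exists_eq_add_of_le hk
  have : k * l ≤ ((k + l) / 2) * ((k + l + 1) / 2) := by
    obtain ⟨q, hq | hq⟩ := Nat.even_or_odd' (k + l)
    · have h1 : (k + l) / 2 = q := by omega
      have h2 : (k + l + 1) / 2 = q := by omega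
      rw [h1, h2]
      zify at *
      nlinarith [sq_nonneg ((k : ℤ) - l)]
    · have h1 : (k + l) / 2 = q := by omega
      have h2 : (k + l + 1) / 2 = q + 1 := by omega
      rw [h1, h2]
      rcases le_total k q with h | h
      · obtain ⟨r, rfl⟩ := Nat.exists_eq_add_of_le h
        have : l = k + 2 * r + 1 := by omega
        subst this; nlinarith
      · rcases Nat.eq_or_lt_of_le h with h | h
        · subst h
          have : l = q + 1 := by omega
          rw [this]
        obtain ⟨r, rfl⟩ := Nat.exists_eq_add_of_le (show q + 1 ≤ k from h)
        have : q = l + r := by omega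
        subst this; nlinarith
  have h2 : ((k * l : ℕ) : ℝ) ≤ (((k + l) / 2 * ((k + l + 1) / 2) : ℕ) : ℝ) := by
    exact_mod_cast this
  rw [Nat.cast_mul, Nat.cast_mul] at h2
  push_cast at h2 ⊢
  linarith

lemma cube_bound {ι : Type*} [Fintype ι] (y : ι → ℝ) (hy : ∀ i, y i ∈ Set.Icc (0 : ℝ) 1) :
    (Fintype.card ι : ℝ) * ∑ i, y i ^ 2 - (∑ i, y i) ^ 2 ≤
      (Fintype.card ι / 2 : ℕ) * ((Fintype.card ι + 1) / 2 : ℕ) := by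
  classical
  have expand : ∀ y : ι → ℝ, ∑ i, ∑ j, (y i - y j) ^ 2 =
      2 * ((Fintype.card ι : ℝ) * ∑ i, y i ^ 2 - (∑ i, y i) ^ 2) := by
    intro y
    have : ∀ i j, (y i - y j) ^ 2 = y i ^ 2 + y j ^ 2 - 2 * (y i * y j) := fun i j => by ring
    simp only [this, Finset.sum_sub_distrib, Finset.sum_add_distrib, ← Finset.mul_sum,
      ← Finset.sum_mul]
    simp [← Finset.mul_sum]
    ring
  have hconv : ConvexOn ℝ Set.univ (fun y : ι → ℝ => ∑ i, ∑ j, (y i - y j) ^ 2) := by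
    refine ⟨convex_univ, ?_⟩
    intro x _ z _ a c ha hc hac
    simp only [smul_eq_mul, Pi.add_apply, Pi.smul_apply, Finset.mul_sum,
      ← Finset.sum_add_distrib]
    refine Finset.sum_le_sum fun i _ => Finset.sum_le_sum fun j _ => ?_
    obtain rfl : c = 1 - a := by linarith
    nlinarith [mul_nonneg (mul_nonneg ha hc) (sq_nonneg ((x i - x j) - (z i - z j)))]
  have hmem : y ∈ convexHull ℝ (Set.univ.pi fun _ : ι => ({0, 1} : Set ℝ)) := by
    rw [convexHull_pi]
    intro i _
    rw [convexHull_pair, segment_eq_Icc zero_le_one]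
    exact hy i
  obtain ⟨z, hz, hle⟩ := hconv.exists_ge_of_mem_convexHull (Set.subset_univ _) hmem
  simp only [expand] at hle
  refine le_trans (by linarith) (?_ : (Fintype.card ι : ℝ) * ∑ i, z i ^ 2 - (∑ i, z i) ^ 2 ≤ _)
  have hz' : ∀ i, z i = if z i = 1 then 1 else 0 := by
    intro i
    rcases hz i (Set.mem_univ i) with h | h
    · rw [h]; simp
    · rw [Set.mem_singleton_iff.1 h]; simp
  have hs : ∑ i, z i = ((univ.filter fun i => z i = 1).card : ℝ) := by
    rw [Finset.sum_congr rfl fun i _ => hz' i]; simp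
  have hsq : ∑ i, z i ^ 2 = ∑ i, z i := by
    refine Finset.sum_congr rfl fun i _ => ?_
    rw [hz' i]; split_ifs <;> simp
  rw [hsq, hs]
  have := nat_split (Fintype.card ι) (univ.filter fun i => z i = 1).card (Finset.card_le_univ _)
  linarith

/-- **Theorem 2 (Perrin, lower bound for σ₁, II).**
For a finite connected simple graph `G` with boundary set `B` (no edge joins two
boundary vertices), `|B| = b ≥ 2`, and boundary diameter `dB`, every function
`v : V → ℝ` with `∑_{i ∈ B} v i = 0` and `∑_{i ∈ B} (v i)² = 1` has Dirichlet
energy at least `b / (⌊b/2⌋ · ⌈b/2⌉ · dB)`; equivalently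
`σ₁ ≥ b / (⌊b/2⌋ · ⌈b/2⌉ · dB)`. -/
theorem steklov_lower_bound_II {V : Type*} [Fintype V] [DecidableEq V]
    (G : SimpleGraph V) [DecidableRel G.Adj] (hconn : G.Connected)
    (B : Finset V) (b : ℕ) (hb : B.card = b) (hb2 : 2 ≤ b)
    (hBedge : ∀ i ∈ B, ∀ j ∈ B, ¬ G.Adj i j)
    (dB : ℕ) (hdB : dB = (B ×ˢ B).sup fun p => G.dist p.1 p.2)
    (v : V → ℝ) (hsum : ∑ i ∈ B, v i = 0) (hnorm : ∑ i ∈ B, (v i) ^ 2 = 1) :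
    (b : ℝ) / ((b / 2 : ℕ) * ((b + 1) / 2 : ℕ) * dB) ≤
      ∑ e ∈ G.edgeFinset,
        Sym2.lift ⟨fun i j => (v i - v j) ^ 2, fun i j => by ring⟩ e := by
  set f : Sym2 V → ℝ := Sym2.lift ⟨fun i j => (v i - v j) ^ 2, fun i j => by ring⟩ with hfdef
  have hf : ∀ i j, f s(i, j) = (v i - v j) ^ 2 := fun i j => rfl
  have hf0 : ∀ e, 0 ≤ f e := by
    intro e
    induction e with
    | h i j => rw [hf]; positivity
  have hE : 0 ≤ ∑ e ∈ G.edgeFinset, f e := Finset.sum_nonneg fun e _ => hf0 e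
  have hne : B.Nonempty := Finset.card_pos.1 (by omega)
  obtain ⟨p, hp, hpmax⟩ := B.exists_max_image v hne
  obtain ⟨q, hq, hqmin⟩ := B.exists_min_image v hne
  have hpath : (v p - v q) ^ 2 ≤ dB * ∑ e ∈ G.edgeFinset, f e := by
    obtain ⟨w, hw, hlen⟩ := hconn.exists_path_of_dist p q
    have h1 := walk_energy G v f hf w
    have h2 : (w.edges.map f).sum ≤ ∑ e ∈ G.edgeFinset, f e := by
      rw [← List.sum_toFinset f hw.isTrail.edges_nodup]
      refine Finset.sum_le_sum_of_subset_of_nonneg ?_ fun e _ _ => hf0 e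
      intro e he
      rw [SimpleGraph.mem_edgeFinset]
      exact w.edges_subset_edgeSet (List.mem_toFinset.1 he)
    have h3 : w.length ≤ dB := by
      rw [hlen, hdB]
      exact Finset.le_sup (f := fun p : V × V => G.dist p.1 p.2)
        (Finset.mem_product.2 ⟨hp, hq⟩ : (p, q) ∈ B ×ˢ B)
    have h3' : (w.length : ℝ) ≤ dB := by exact_mod_cast h3
    calc _ ≤ _ := h1
      _ ≤ (w.length : ℝ) * ∑ e ∈ G.edgeFinset, f e := by gcongr
      _ ≤ _ := by gcongr
  have hpq : v q < v p := by
    by_contra hcon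
    have hc : ∀ i ∈ B, v i = v p := fun i hi => le_antisymm (hpmax i hi)
      ((not_lt.1 hcon).trans (hqmin i hi))
    rw [Finset.sum_congr rfl hc] at hsum
    have h0 : v p = 0 := by
      simp only [Finset.sum_const, nsmul_eq_mul, mul_eq_zero, Nat.cast_eq_zero] at hsum
      rcases hsum with h | h
      · omega
      · exact h
    rw [Finset.sum_congr rfl fun i hi => by rw [hc i hi, h0]] at hnorm
    simp at hnorm
  have hD : 0 < v p - v q := by linarith
  have hcube := cube_bound (fun i : B => (v i - v q) / (v p - v q)) (by
    intro i
    refine ⟨div_nonneg (by linarith [hqmin i i.2]) hD.le, ?_⟩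
    rw [div_le_one hD]; linarith [hpmax i i.2])
  rw [Fintype.card_coe, hb,
    Finset.sum_coe_sort B (fun i => ((v i - v q) / (v p - v q)) ^ 2),
    Finset.sum_coe_sort B (fun i => ((v i - v q) / (v p - v q))), ← Finset.sum_div] at hcube
  simp only [div_pow] at hcube
  rw [← Finset.sum_div] at hcube
  have e1 : ∑ i ∈ B, (v i - v q) = - (b * v q) := by
    rw [Finset.sum_sub_distrib, hsum]; simp [hb]
  have e2 : ∑ i ∈ B, (v i - v q) ^ 2 = 1 + b * v q ^ 2 := by
    have : ∀ i, (v i - v q) ^ 2 = v i ^ 2 - 2 * v q * v i + v q ^ 2 := fun i => by ring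
    simp only [this, Finset.sum_add_distrib, Finset.sum_sub_distrib, ← Finset.mul_sum]
    rw [hsum, hnorm]; simp [hb]
  rw [e1, e2] at hcube
  have e3 : (b : ℝ) * ((1 + b * v q ^ 2) / (v p - v q) ^ 2) - (-(b * v q)) ^ 2 / (v p - v q) ^ 2
      = b / (v p - v q) ^ 2 := by ring
  rw [e3, div_le_iff₀ (by positivity)] at hcube
  refine div_le_of_le_mul₀ (by positivity) hE ?_
  refine hcube.trans ?_
  calc _ ≤ ((b / 2 : ℕ) * ((b + 1) / 2 : ℕ) : ℝ) * (dB * ∑ e ∈ G.edgeFinset, f e) := by gcongr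
    _ = _ := by ring
end

section
/- For an integer b ≥ 2, let D_b = {x ∈ ℝ^b : x_1 ≥ x_2 ≥ … ≥ x_b} and S_b = {x ∈ ℝ^b : ∑_{i=1}^b x_i² = 1 and ∑_{i=1}^b x_i = 0}. Then the function f_b(x) = x_1 − x_b attains a minimum on D_b ∩ S_b, and this minimum equals √b/(√⌊b/2⌋·√⌈b/2⌉); that is, every x ∈ D_b ∩ S_b satisfies x_1 − x_b ≥ √b/(√⌊b/2⌋·√⌈b/2⌉), and some x ∈ D_b ∩ S_b attains equality. -/
open Finset

lemma aux_ite (p q : ℕ) (A B : ℝ) :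
    ∑ i ∈ Finset.range (p + q), (if i < p then A else B) = p * A + q * B := by
  induction q with
  | zero =>
    rw [Nat.add_zero, Finset.sum_congr rfl (g := fun _ => A)]
    · simp
    · intro i hi
      simp [Finset.mem_range.1 hi]
  | succ q ih =>
    rw [← Nat.add_assoc, Finset.sum_range_succ, ih, if_neg (by omega)]
    push_cast
    ring

def auxS (i j : ℕ) : ℝ := if j < i then -1 else if i < j then 1 else 0

lemma aux_sign (i b : ℕ) :
    ∑ j ∈ Finset.range b, auxS i j = if b ≤ i then -(b : ℝ) else (b : ℝ) - 1 - 2 * i := by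
  induction b with
  | zero => simp
  | succ b ih =>
    rw [Finset.sum_range_succ, ih, auxS]
    rcases lt_trichotomy b i with h | h | h
    · rw [if_pos h.le, if_pos h, if_pos (by omega)]; push_cast; ring
    · subst h; simp; ring
    · rw [if_neg (by omega), if_neg (by omega), if_pos h, if_neg (by omega)]; push_cast; ring

lemma aux_abs (b : ℕ) :
    ∑ i ∈ Finset.range b, |(b : ℝ) - 1 - 2 * i| = 2 * ((b / 2 : ℕ) : ℝ) * ((b + 1) / 2 : ℕ) := by
  induction b using Nat.twoStepInduction with
  | zero => simp
  | one => simp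
  | more b ih _ =>
    have h1 : (b + 2) / 2 = b / 2 + 1 := by omega
    have h2 : (b + 2 + 1) / 2 = (b + 1) / 2 + 1 := by omega
    have h3 : ((b / 2 : ℕ) : ℝ) + ((b + 1) / 2 : ℕ) = b := by
      exact_mod_cast (by omega : b / 2 + (b + 1) / 2 = b)
    have hb : (0 : ℝ) ≤ b := Nat.cast_nonneg b
    rw [Finset.sum_range_succ, Finset.sum_range_succ', h1, h2]
    have : ∀ i ∈ Finset.range b, |((b + 2 : ℕ) : ℝ) - 1 - 2 * ((i + 1 : ℕ) : ℝ)|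
        = |(b : ℝ) - 1 - 2 * i| := by
      intro i _
      congr 1
      push_cast
      ring
    rw [Finset.sum_congr rfl this, ih, abs_of_nonneg (by push_cast; linarith),
      abs_of_nonpos (by push_cast; linarith)]
    push_cast
    linear_combination (-2 : ℝ) * h3

lemma aux_bound (b : ℕ) (x : Fin b → ℝ) (hx : Antitone x) (h2 : ∑ i, (x i) ^ 2 = 1)
    (h1 : ∑ i, x i = 0) (d : ℝ) (hd : ∀ i j, x i - x j ≤ d) (hd0 : 0 ≤ d) :
    (b : ℝ) ≤ d ^ 2 * (((b / 2 : ℕ) : ℝ) * ((b + 1) / 2 : ℕ)) := by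
  have e1 : ∑ i, ∑ j, (x i - x j) ^ 2 = 2 * b := by
    have : ∀ i, ∑ j, (x i - x j) ^ 2 = b * x i ^ 2 + 1 := by
      intro i
      have : ∀ j, (x i - x j) ^ 2 = x i ^ 2 - 2 * x i * x j + x j ^ 2 := fun j => by ring
      simp only [this, Finset.sum_add_distrib, Finset.sum_sub_distrib, ← Finset.mul_sum, h1, h2]
      simp
    simp only [this, Finset.sum_add_distrib, ← Finset.mul_sum, h2]
    simp
    ring
  have e2 : ∀ i j : Fin b, (x i - x j) ^ 2 ≤ d * (auxS i j * (x i - x j)) := by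
    intro i j
    unfold auxS
    rcases lt_trichotomy (i : ℕ) j with h | h | h
    · rw [if_neg (by omega), if_pos h]
      have := hx (show i ≤ j from h.le)
      nlinarith [hd i j]
    · have : i = j := Fin.ext h
      subst this
      simp
    · rw [if_pos h]
      have := hx (show j ≤ i from h.le)
      nlinarith [hd j i]
  have hS : ∀ i : Fin b, ∑ j : Fin b, auxS i j = (b : ℝ) - 1 - 2 * (i : ℕ) := by
    intro i
    rw [Fin.sum_univ_eq_sum_range (fun j => auxS i j), aux_sign, if_neg (by omega)]
  have hanti : ∀ i j, auxS i j = - auxS j i := by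
    intro i j
    unfold auxS
    rcases lt_trichotomy i j with h | h | h
    · simp [h, h.not_gt]
    · simp [h]
    · simp [h, h.not_gt]
  have e3 : ∑ i : Fin b, ∑ j : Fin b, auxS i j * (x i - x j)
      = 2 * ∑ i : Fin b, ((b : ℝ) - 1 - 2 * (i : ℕ)) * x i := by
    simp only [mul_sub, Finset.sum_sub_distrib]
    rw [Finset.sum_comm (f := fun i j : Fin b => auxS i j * x j)]
    simp only [← Finset.sum_mul, hS]
    have : ∀ j : Fin b, ∑ i : Fin b, auxS i j = -((b : ℝ) - 1 - 2 * (j : ℕ)) := by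
      intro j
      rw [← hS j, ← Finset.sum_neg_distrib]
      exact Finset.sum_congr rfl fun i _ => hanti _ _
    simp only [this, neg_mul, Finset.sum_neg_distrib]
    ring
  have e4 : ∑ i : Fin b, ((b : ℝ) - 1 - 2 * (i : ℕ)) * x i
      = - ∑ i : Fin b, ((b : ℝ) - 1 - 2 * (i : ℕ)) * x (Fin.rev i) := by
    rw [← Equiv.sum_comp Fin.revPerm, ← Finset.sum_neg_distrib]
    refine Finset.sum_congr rfl fun i _ => ?_
    have : ((Fin.rev i : Fin b) : ℕ) + i + 1 = b := by
      rw [Fin.val_rev]; omega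
    have h : (((Fin.rev i : Fin b) : ℕ) : ℝ) + (i : ℕ) + 1 = b := by exact_mod_cast this
    simp only [Fin.revPerm_apply]
    linear_combination (-2 * x i.rev) * h
  have e5 : 2 * ∑ i : Fin b, ((b : ℝ) - 1 - 2 * (i : ℕ)) * x i
      ≤ ∑ i : Fin b, |(b : ℝ) - 1 - 2 * (i : ℕ)| * d := by
    have : 2 * ∑ i : Fin b, ((b : ℝ) - 1 - 2 * (i : ℕ)) * x i
      = ∑ i : Fin b, ((b : ℝ) - 1 - 2 * (i : ℕ)) * (x i - x (Fin.rev i)) := by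
      simp only [mul_sub _ (x _), Finset.sum_sub_distrib]
      linarith
    rw [this]
    refine Finset.sum_le_sum fun i _ => ?_
    refine (le_abs_self _).trans ?_
    rw [abs_mul]
    refine mul_le_mul_of_nonneg_left ?_ (abs_nonneg _)
    exact abs_le.2 ⟨by linarith [hd (Fin.rev i) i], hd _ _⟩
  rw [← Finset.sum_mul, Fin.sum_univ_eq_sum_range (fun i => |(b : ℝ) - 1 - 2 * (i : ℕ)|),
    aux_abs] at e5
  have e6 : ∑ i, ∑ j, (x i - x j) ^ 2 ≤ d * ∑ i : Fin b, ∑ j : Fin b, auxS i j * (x i - x j) := by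
    simp only [Finset.mul_sum]
    exact Finset.sum_le_sum fun i _ => Finset.sum_le_sum fun j _ => e2 i j
  rw [e1, e3] at e6
  have := mul_le_mul_of_nonneg_left e5 hd0
  linarith

/-- **Proposition (constrained minimum of `x₁ - x_b`).**
For an integer `b ≥ 2`, the minimum of `f_b(x) = x₁ - x_b` over the set of
nonincreasing `x ∈ ℝᵇ` with `∑ xᵢ² = 1` and `∑ xᵢ = 0` is attained and equals
`√b / (√⌊b/2⌋ · √⌈b/2⌉)`. -/
theorem min_first_minus_last (b : ℕ) (hb : 2 ≤ b) :
    IsLeast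
      {t : ℝ | ∃ x : Fin b → ℝ, Antitone x ∧ (∑ i, (x i) ^ 2 = 1) ∧ (∑ i, x i = 0) ∧
        t = x ⟨0, by omega⟩ - x ⟨b - 1, by omega⟩}
      (Real.sqrt b / (Real.sqrt (b / 2 : ℕ) * Real.sqrt ((b + 1) / 2 : ℕ))) := by
  have hp : (0 : ℝ) < (b / 2 : ℕ) := by exact_mod_cast (by omega : 0 < b / 2)
  have hq : (0 : ℝ) < ((b + 1) / 2 : ℕ) := by exact_mod_cast (by omega : 0 < (b + 1) / 2)
  have hpqN : b / 2 + (b + 1) / 2 = b := by omega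
  have hpq : ((b / 2 : ℕ) : ℝ) + ((b + 1) / 2 : ℕ) = b := by exact_mod_cast hpqN
  have hb0 : (0 : ℝ) < b := by linarith
  constructor
  · have hps : 0 < b / 2 := by omega
    have hpl : ¬ (b - 1 < b / 2) := by omega
    generalize b / 2 = p at *
    generalize (b + 1) / 2 = q at *
    have sp := Real.sqrt_pos.2 hp
    have sq := Real.sqrt_pos.2 hq
    have sb := Real.sqrt_pos.2 hb0
    have tp := Real.sq_sqrt hp.le
    have tq := Real.sq_sqrt hq.le
    have tb := Real.sq_sqrt hb0.le
    set u := Real.sqrt p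
    set v := Real.sqrt q
    set w := Real.sqrt b
    have key : ∀ A B : ℝ, ∑ i : Fin b, (if (i : ℕ) < p then A else B) = p * A + q * B := by
      intro A B
      rw [Fin.sum_univ_eq_sum_range (fun i => if i < p then A else B), ← aux_ite, hpqN]
    refine ⟨fun i => if (i : ℕ) < p then v / (u * w) else -(u / (v * w)), ?_, ?_, ?_, ?_⟩
    · intro i j hij
      have hij' : (i : ℕ) ≤ j := hij
      have a1 : 0 < v / (u * w) := by positivity
      have a2 : 0 < u / (v * w) := by positivity
      dsimp only
      split_ifs
      · exact le_rfl
      · omega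
      · linarith
      · exact le_rfl
    · simp only [ite_pow, key]
      rw [← tp, ← tq]
      field_simp
      linarith
    · simp only [key]
      rw [← tp, ← tq]
      field_simp
      ring
    · simp only [hps, hpl, if_true, if_false]
      field_simp
      linarith
  · rintro t ⟨x, hx, h2, h1, rfl⟩
    have hd : ∀ i j, x i - x j ≤ x ⟨0, by omega⟩ - x ⟨b - 1, by omega⟩ := by
      intro i j
      have a1 : x i ≤ x ⟨0, by omega⟩ := hx (Fin.le_def.2 (Nat.zero_le _))
      have a2 : x ⟨b - 1, by omega⟩ ≤ x j := hx (Fin.le_def.2 (by have := j.2; simp; omega))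
      linarith
    have hd0 : 0 ≤ x ⟨0, by omega⟩ - x ⟨b - 1, by omega⟩ := by
      simpa using hd ⟨0, by omega⟩ ⟨0, by omega⟩
    have := aux_bound b x hx h2 h1 _ hd hd0
    rw [← Real.sqrt_mul hp.le, ← Real.sqrt_div hb0.le]
    refine Real.sqrt_le_iff.2 ⟨hd0, ?_⟩
    rwa [div_le_iff₀ (by positivity)]
end

section
/- Let B be a finite set with |B| = b ≥ 2 and let v : B → ℝ satisfy ∑_{i∈B} v_i = 0 and ∑_{i∈B} v_i² = 1. Then (max_{i∈B} v_i) − (min_{i∈B} v_i) ≥ √b/(√⌊b/2⌋·√⌈b/2⌉). -/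
open Finset

theorem aux_conv {α : Type*} (v : α → ℝ) (R n : ℝ) (hn : 1 ≤ n) (s : Finset α)
    (h0 : ∀ i ∈ s, 0 ≤ v i) (h1 : ∀ i ∈ s, v i ≤ R) :
    ∀ Q : ℝ, ∃ k : ℕ, k ≤ s.card ∧
      n * (∑ i ∈ s, v i ^ 2) - (∑ i ∈ s, v i + Q) ^ 2 ≤ n * (k * R ^ 2) - (k * R + Q) ^ 2 := by
  classical
  induction s using Finset.induction_on with
  | empty => intro Q; exact ⟨0, by simp, by simp⟩
  | insert a s ha ih =>
    intro Q
    obtain ⟨k, hk, h⟩ := ih (fun i hi => h0 i (by simp [hi])) (fun i hi => h1 i (by simp [hi]))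
      (Q + v a)
    have ha0 := h0 a (by simp)
    have ha1 := h1 a (by simp)
    rw [Finset.sum_insert ha, Finset.sum_insert ha, Finset.card_insert_of_notMem ha]
    generalize v a = x at *
    by_cases hc : (n - 1) * R - 2 * (k * R + Q) ≤ 0
    · refine ⟨k, by omega, ?_⟩
      have e1 : (n - 1) * x - 2 * (k * R + Q) ≤ 0 := by nlinarith
      nlinarith [mul_nonneg ha0 (neg_nonneg.2 e1)]
    · refine ⟨k + 1, by omega, ?_⟩
      push_cast
      have e1 : 0 ≤ (n - 1) * (R + x) - 2 * (k * R + Q) := by nlinarith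
      nlinarith [mul_nonneg (sub_nonneg.2 ha1) e1]

theorem aux_nat (b k : ℕ) : (k : ℝ) * (b - k) ≤ ((b / 2 : ℕ) : ℝ) * (((b + 1) / 2 : ℕ) : ℝ) := by
  have key : (k : ℤ) * (b - k) ≤ ((b / 2 : ℕ) : ℤ) * (((b + 1) / 2 : ℕ) : ℤ) := by
    obtain ⟨f, hf | hf⟩ := Nat.even_or_odd' b
    · have h1 : b / 2 = f := by omega
      have h2 : (b + 1) / 2 = f := by omega
      rw [h1, h2, hf]; push_cast
      nlinarith [sq_nonneg ((k : ℤ) - f)]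
    · have h1 : b / 2 = f := by omega
      have h2 : (b + 1) / 2 = f + 1 := by omega
      rw [h1, h2, hf]; push_cast
      rcases le_or_gt k f with h | h
      · have : (k : ℤ) ≤ f := by exact_mod_cast h
        nlinarith
      · have : (f : ℤ) + 1 ≤ k := by exact_mod_cast h
        nlinarith
  have key2 := (Int.cast_le (R := ℝ)).2 key
  simpa only [Int.cast_mul, Int.cast_sub, Int.cast_natCast] using key2

/-- **Improved gap bound on the boundary.**
If `B` is a finite set with `|B| = b ≥ 2` and `v : B → ℝ` satisfies
`∑_{i∈B} v i = 0` and `∑_{i∈B} (v i)² = 1`, then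
`max_B v - min_B v ≥ √b / (√⌊b/2⌋ · √⌈b/2⌉)`. -/
theorem boundary_gap_improved {α : Type*} (B : Finset α) (hne : B.Nonempty)
    (b : ℕ) (hb : B.card = b) (hb2 : 2 ≤ b) (v : α → ℝ)
    (hsum : ∑ i ∈ B, v i = 0) (hnorm : ∑ i ∈ B, (v i) ^ 2 = 1) :
    Real.sqrt b / (Real.sqrt (b / 2 : ℕ) * Real.sqrt ((b + 1) / 2 : ℕ)) ≤
      B.sup' hne v - B.inf' hne v := by
  have hm : ∀ i ∈ B, B.inf' hne v ≤ v i := fun i hi => Finset.inf'_le v hi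
  have hM : ∀ i ∈ B, v i ≤ B.sup' hne v := fun i hi => Finset.le_sup' v hi
  generalize B.inf' hne v = m at *
  generalize B.sup' hne v = M at *
  have hR : 0 ≤ M - m := by
    obtain ⟨i, hi⟩ := hne
    linarith [hm i hi, hM i hi]
  have hb1 : (1 : ℝ) ≤ b := by exact_mod_cast (by omega : 1 ≤ b)
  obtain ⟨k, -, h⟩ := aux_conv (fun i => v i - m) (M - m) b hb1 B
    (fun i hi => sub_nonneg.2 (hm i hi)) (fun i hi => by simpa using hM i hi) 0
  have s1 : ∑ i ∈ B, (v i - m) = - (b * m) := by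
    rw [Finset.sum_sub_distrib, hsum]; simp [hb]
  have s2 : ∑ i ∈ B, (v i - m) ^ 2 = 1 + b * m ^ 2 := by
    have : ∀ i, (v i - m) ^ 2 = v i ^ 2 - 2 * m * v i + m ^ 2 := fun i => by ring
    simp only [this]
    rw [Finset.sum_add_distrib, Finset.sum_sub_distrib, ← Finset.mul_sum, hsum, hnorm]
    simp [hb]
  simp only [s1, s2] at h
  have hk := mul_le_mul_of_nonneg_left (aux_nat b k) (sq_nonneg (M - m))
  have hf : (0 : ℝ) < (b / 2 : ℕ) := by exact_mod_cast (by omega : 0 < b / 2)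
  have hc : (0 : ℝ) < ((b + 1) / 2 : ℕ) := by exact_mod_cast (by omega : 0 < (b + 1) / 2)
  rw [← Real.sqrt_mul hf.le, ← Real.sqrt_div (by linarith)]
  apply Real.sqrt_le_iff.2 ⟨hR, ?_⟩
  rw [div_le_iff₀ (mul_pos hf hc)]
  nlinarith
end

section
/- Let B be a finite set with |B| = b ≥ 2 and let v : B → ℝ satisfy ∑_{i∈B} v_i = 0 and ∑_{i∈B} v_i² = 1. Then (max_{i∈B} v_i) − (min_{i∈B} v_i) ≥ b/((b−1)·√b) = √b/(b−1). -/
open Finset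

/-- **Basic gap bound on the boundary.**
If `B` is a finite set with `|B| = b ≥ 2` and `v : B → ℝ` satisfies
`∑_{i∈B} v i = 0` and `∑_{i∈B} (v i)² = 1`, then
`max_B v - min_B v ≥ b / ((b-1)·√b) = √b / (b-1)`. -/
theorem boundary_gap_basic {α : Type*} (B : Finset α) (hne : B.Nonempty)
    (b : ℕ) (hb : B.card = b) (hb2 : 2 ≤ b) (v : α → ℝ)
    (hsum : ∑ i ∈ B, v i = 0) (hnorm : ∑ i ∈ B, (v i) ^ 2 = 1) :
    (b : ℝ) / (((b : ℝ) - 1) * Real.sqrt b) ≤ B.sup' hne v - B.inf' hne v ∧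
      (b : ℝ) / (((b : ℝ) - 1) * Real.sqrt b) = Real.sqrt b / ((b : ℝ) - 1) := by
  have hbR : (2 : ℝ) ≤ b := by exact_mod_cast hb2
  have hs : 0 < Real.sqrt b := Real.sqrt_pos.mpr (by linarith)
  have hss : Real.sqrt b * Real.sqrt b = b := Real.mul_self_sqrt (by linarith)
  have h1 : (0 : ℝ) < (b : ℝ) - 1 := by linarith
  have heq : (b : ℝ) / (((b : ℝ) - 1) * Real.sqrt b) = Real.sqrt b / ((b : ℝ) - 1) := by
    rw [div_eq_div_iff (by positivity) (by positivity)]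
    linear_combination (-((b : ℝ) - 1)) * hss
  refine ⟨?_, heq⟩
  have hM : ∀ i ∈ B, v i ≤ B.sup' hne v := fun i hi => Finset.le_sup' v hi
  have hm : ∀ i ∈ B, B.inf' hne v ≤ v i := fun i hi => Finset.inf'_le v hi
  have hD : B.inf' hne v ≤ B.sup' hne v := by
    obtain ⟨i, hi⟩ := hne
    exact (hm i hi).trans (hM i hi)
  generalize B.sup' hne v = M at *
  generalize B.inf' hne v = m at *
  have h0 : 0 ≤ ∑ i ∈ B, (M - v i) * (v i - m) :=
    Finset.sum_nonneg fun i hi =>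
      mul_nonneg (sub_nonneg.mpr (hM i hi)) (sub_nonneg.mpr (hm i hi))
  have h2 : ∑ i ∈ B, (M - v i) * (v i - m) = -1 - b * (M * m) := by
    have : ∀ i ∈ B, (M - v i) * (v i - m) = (M + m) * v i - v i ^ 2 - M * m := by
      intro i _; ring
    rw [Finset.sum_congr rfl this, Finset.sum_sub_distrib, Finset.sum_sub_distrib,
      ← Finset.mul_sum, hsum, hnorm, Finset.sum_const, hb, nsmul_eq_mul]
    ring
  have h3 : 4 ≤ (b : ℝ) * (M - m) ^ 2 := by
    nlinarith [mul_nonneg (by linarith : (0 : ℝ) ≤ b) (sq_nonneg (M + m))]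
  have h4 : 2 ≤ Real.sqrt b * (M - m) := by
    refine abs_le_of_sq_le_sq' ?_ (mul_nonneg hs.le (sub_nonneg.mpr hD)) |>.2
    have : (Real.sqrt b * (M - m)) ^ 2 = (b : ℝ) * (M - m) ^ 2 := by
      linear_combination (M - m) ^ 2 * hss
    rw [this]; linarith
  rw [div_le_iff₀ (by positivity)]
  nlinarith
end

section
/- Let Γ = (V, E) be a finite connected simple graph, B ⊆ V a nonempty subset, and I = V \ B. Then the principal submatrix [Δ]_I of the Laplacian matrix Δ of Γ, obtained by keeping the rows and columns indexed by the vertices of I, is invertible. -/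
open Finset

/-- **Invertibility of the interior principal submatrix of the Laplacian.**
For a finite connected simple graph `G` and a nonempty subset `B` of vertices,
the principal submatrix of the Laplacian matrix obtained by keeping the rows
and columns indexed by the interior `I = V \ B` is invertible. -/
theorem lapMatrix_interior_submatrix_isUnit {V : Type*} [Fintype V] [DecidableEq V]
    (G : SimpleGraph V) [DecidableRel G.Adj] (hconn : G.Connected)
    (B : Finset V) (hne : B.Nonempty) :
    IsUnit ((G.lapMatrix ℝ).submatrix (Subtype.val : {i : V // i ∉ B} → V)
      (Subtype.val : {i : V // i ∉ B} → V)) := by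
  rw [Matrix.isUnit_iff_isUnit_det, isUnit_iff_ne_zero]
  intro hdet
  obtain ⟨v, hv, hMv⟩ := Matrix.exists_mulVec_eq_zero_iff.mpr hdet
  let x : V → ℝ := fun i => if h : i ∉ B then v ⟨i, h⟩ else 0
  have hxv : ∀ i : {i : V // i ∉ B}, x i = v i := fun i => dif_pos i.2
  have hxB : ∀ i ∈ B, x i = 0 := fun i hi => dif_neg (not_not.mpr hi)
  have hL : ∀ i, i ∉ B → Matrix.mulVec (G.lapMatrix ℝ) x i = 0 := by
    intro i hi
    have h1 := congrFun hMv ⟨i, hi⟩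
    simp only [Matrix.mulVec, dotProduct, Matrix.submatrix_apply, Pi.zero_apply] at h1 ⊢
    rw [← h1, ← Fintype.sum_subtype_add_sum_subtype (fun j => j ∉ B)]
    have h2 : ∑ j : {j // ¬ (j ∉ B)}, G.lapMatrix ℝ i j * x j = 0 :=
      Finset.sum_eq_zero fun j _ => by rw [hxB j (not_not.mp j.2), mul_zero]
    rw [h2, add_zero]
    exact Finset.sum_congr rfl fun j _ => by rw [hxv]
  have hq : Matrix.toLinearMap₂' ℝ (G.lapMatrix ℝ) x x = 0 := by
    rw [Matrix.toLinearMap₂'_apply']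
    refine Finset.sum_eq_zero fun i _ => ?_
    by_cases hi : i ∈ B
    · rw [hxB i hi, zero_mul]
    · rw [hL i hi, mul_zero]
  rw [SimpleGraph.lapMatrix_toLinearMap₂'_apply'_eq_zero_iff_forall_reachable] at hq
  obtain ⟨b, hb⟩ := hne
  apply hv
  funext i
  rw [← hxv, hq i b (hconn.preconnected i b), hxB b hb, Pi.zero_apply]
end

section
/- Let m ≥ 1 and L ≥ 1 be integers and set b = 2m. Consider the graph H with vertex set consisting of m left boundary vertices a_1, …, a_m, m right boundary vertices c_1, …, c_m, and interior path vertices p_0, p_1, …, p_L, whose edges are: a_s ∼ p_0 for each s, c_s ∼ p_L for each s, and p_i ∼ p_{i+1} for 0 ≤ i < L. Let B = {a_1, …, a_m, c_1, …, c_m}, so that the boundary diameter is d_B = L + 2. Then the minimum of the Dirichlet energy ∑_{{i,j}∈E} (v_i − v_j)² over all v : V(H) → ℝ with ∑_{i∈B} v_i = 0 and ∑_{i∈B} v_i² = 1 exists and equals 4/(bL + 4) = b/(⌊b/2⌋·⌈b/2⌉·(d_B − 2) + b); that is, σ₁(H, B) = b/(⌊b/2⌋·⌈b/2⌉·(d_B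 − 2) + b). -/
open Finset

/-- **Steklov eigenvalue of the sharpness example `(H^b)_{d_B}` for even `b = 2m`.**
The graph `H` has `m` left boundary leaves attached to one end `p₀` of an
interior path `p₀, …, p_L` and `m` right boundary leaves attached to the other
end `p_L`; the boundary diameter is `d_B = L + 2`.  The minimum of the Dirichlet
energy over all `v` with `∑_{i∈B} v i = 0` and `∑_{i∈B} (v i)² = 1` exists and
equals `4/(bL + 4) = b/(⌊b/2⌋·⌈b/2⌉·(d_B - 2) + b)`. -/
theorem steklov_sharpness_graph (m L : ℕ) (hm : 1 ≤ m) (hL : 1 ≤ L) :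
    IsLeast
      {E : ℝ | ∃ v : (Fin m ⊕ Fin m ⊕ Fin (L + 1)) → ℝ,
        ((∑ s : Fin m, v (Sum.inl s)) + ∑ s : Fin m, v (Sum.inr (Sum.inl s)) = 0) ∧
        ((∑ s : Fin m, (v (Sum.inl s)) ^ 2) +
            ∑ s : Fin m, (v (Sum.inr (Sum.inl s))) ^ 2 = 1) ∧
        E = (∑ s : Fin m, (v (Sum.inl s) - v (Sum.inr (Sum.inr 0))) ^ 2) +
            (∑ s : Fin m,
              (v (Sum.inr (Sum.inl s)) - v (Sum.inr (Sum.inr (Fin.last L)))) ^ 2) +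
            ∑ i : Fin L,
              (v (Sum.inr (Sum.inr i.succ)) - v (Sum.inr (Sum.inr i.castSucc))) ^ 2}
      (4 / (2 * (m : ℝ) * L + 4)) ∧
    4 / (2 * (m : ℝ) * L + 4) = (2 * m : ℝ) / ((m : ℝ) * m * L + 2 * m) := by
  have hm0 : (1:ℝ) ≤ m := by exact_mod_cast hm
  have hL0 : (1:ℝ) ≤ L := by exact_mod_cast hL
  have hmL : 0 < (m:ℝ) * L := by positivity
  have hk : 0 < (m:ℝ) * L + 2 := by positivity
  have hval : 4 / (2 * (m : ℝ) * L + 4) = 2 / ((m:ℝ) * L + 2) := by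
    rw [div_eq_div_iff (by positivity) (by positivity)]; ring
  refine ⟨⟨?_, ?_⟩, ?_⟩
  · obtain ⟨t, ht⟩ : ∃ t : ℝ, 2 * m * t ^ 2 = 1 := by
      refine ⟨Real.sqrt (1 / (2 * m)), ?_⟩
      rw [Real.sq_sqrt (by positivity)]
      field_simp
    refine ⟨Sum.elim (fun _ => t) (Sum.elim (fun _ => -t)
      (fun i => m * t * (L - 2 * ((i : ℕ) : ℝ)) / (m * L + 2))), ?_, ?_, ?_⟩
    · simp
    · simp
      linarith
    · rw [hval]
      have e : ∀ x : ℝ, m * t * (L - 2 * (x + 1)) / (m * L + 2)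
          - m * t * (L - 2 * x) / (m * L + 2) = - (2 * m * t) / (m * L + 2) := by
        intro x; field_simp; ring
      simp only [Sum.elim_inl, Sum.elim_inr, Fin.val_succ, Fin.val_castSucc, Fin.val_zero,
        Fin.val_last, Nat.cast_add, Nat.cast_one, e, Finset.sum_const, Finset.card_univ,
        Fintype.card_fin, nsmul_eq_mul, Nat.cast_zero]
      have h1 : t - m * t * (L - 2 * 0) / (m * L + 2) = 2 * t / (m * L + 2) := by
        field_simp; ring
      have h2 : -t - m * t * (L - 2 * (L:ℝ)) / (m * L + 2) = -(2 * t) / (m * L + 2) := by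
        field_simp; ring
      rw [h1, h2]
      field_simp
      linear_combination (-((m:ℝ) * L + 2)) * ht
  · rintro E ⟨v, h0, h1, rfl⟩
    rw [hval]
    set x : Fin m → ℝ := fun s => v (Sum.inl s) with hx
    set y : Fin m → ℝ := fun s => v (Sum.inr (Sum.inl s)) with hy
    set p : Fin (L + 1) → ℝ := fun s => v (Sum.inr (Sum.inr s)) with hp
    change ∑ s, x s + ∑ s, y s = 0 at h0
    change ∑ s, x s ^ 2 + ∑ s, y s ^ 2 = 1 at h1
    change _ ≤ ∑ s, (x s - p 0) ^ 2 + ∑ s, (y s - p (Fin.last L)) ^ 2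
      + ∑ i : Fin L, (p i.succ - p i.castSucc) ^ 2
    have hex : ∀ (z : Fin m → ℝ) (c : ℝ), ∑ s, (z s - c) ^ 2
        = ∑ s, z s ^ 2 - 2 * c * ∑ s, z s + m * c ^ 2 := by
      intro z c
      have : ∀ s, (z s - c) ^ 2 = z s ^ 2 - 2 * c * z s + c ^ 2 := fun s => by ring
      simp only [this, Finset.sum_add_distrib, Finset.sum_sub_distrib, ← Finset.mul_sum]
      simp
    have hcs : ∀ (n : ℕ) (z : Fin n → ℝ), (∑ s, z s) ^ 2 ≤ n * ∑ s, z s ^ 2 := by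
      intro n z
      simpa using sq_sum_le_card_mul_sum_sq (s := Finset.univ) (f := z)
    have htel : ∀ (n : ℕ) (q : Fin (n + 1) → ℝ),
        ∑ i : Fin n, (q i.succ - q i.castSucc) = q (Fin.last n) - q 0 := by
      intro n q
      rw [Finset.sum_sub_distrib]
      have a1 := Fin.sum_univ_succ q
      have a2 := Fin.sum_univ_castSucc q
      linarith
    have hpath := hcs L (fun i => p i.succ - p i.castSucc)
    rw [htel] at hpath
    have hX := hcs m x
    have hY := hcs m y
    rw [hex, hex]
    generalize p 0 = P at *
    generalize p (Fin.last L) = Q at *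
    generalize ∑ i : Fin L, (p i.succ - p i.castSucc) ^ 2 = W at *
    generalize ∑ s, x s ^ 2 = X at *
    generalize ∑ s, y s ^ 2 = Y at *
    generalize ∑ s, x s = A at *
    obtain hB : ∑ s, y s = -A := by linarith
    rw [hB] at hY ⊢
    have hA : 2 * A ^ 2 ≤ m := by nlinarith
    generalize (m:ℝ) = M at *
    generalize (L:ℝ) = N at *
    rw [div_le_iff₀ hk]
    have hN : 0 < N := by linarith
    obtain rfl : Y = 1 - X := by linarith
    have k1 := mul_le_mul_of_nonneg_left hpath hk.le
    have k2 : 0 ≤ (M * N + 2) * N * M * (P + Q) ^ 2 := by positivity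
    have k3 := mul_le_mul_of_nonneg_left hA (sq_nonneg N)
    have k4 := sq_nonneg ((M * N + 2) * (P - Q) - 2 * N * A)
    refine le_of_mul_le_mul_left ?_ hN
    linarith
  · rw [hval, div_eq_div_iff (by positivity) (by positivity)]; ring
end

section
/- Fix n ≥ 0 and consider the graph D_{n+3} with vertex set {a, b, h, x_1, …, x_n} and edges a ∼ h, b ∼ h, h ∼ x_1 (if n ≥ 1), and x_i ∼ x_{i+1} for 1 ≤ i < n, with boundary B = {a, b}. Then the minimum of the Dirichlet energy ∑_{{i,j}∈E} (v_i − v_j)² over all v with v_a + v_b = 0 and v_a² + v_b² = 1 exists and equals 1; that is, σ₁(D_{n+3}, B) = 2/d_B = 1 (where d_B = 2) independently of n, even though the diameter of the graph is n + 2. -/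
open Finset

/-- **The example `D_{n+3}`.**
The graph `D_{n+3}` has two boundary vertices `a, b` attached to a hub `h`,
from which a path of `n` further interior vertices emanates (here the interior
path is `h = x₀, x₁, …, x_n`).  The minimum of the Dirichlet energy over all
`v` with `v a + v b = 0` and `(v a)² + (v b)² = 1` exists and equals `1`;
that is, `σ₁(D_{n+3}) = 2/d_B = 1` (with `d_B = 2`) independently of `n`. -/
theorem steklov_D_graph (n : ℕ) :
    IsLeast
      {E : ℝ | ∃ v : (Fin 2 ⊕ Fin (n + 1)) → ℝ,
        v (Sum.inl 0) + v (Sum.inl 1) = 0 ∧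
        (v (Sum.inl 0)) ^ 2 + (v (Sum.inl 1)) ^ 2 = 1 ∧
        E = (v (Sum.inl 0) - v (Sum.inr 0)) ^ 2 +
            (v (Sum.inl 1) - v (Sum.inr 0)) ^ 2 +
            ∑ i : Fin n, (v (Sum.inr i.succ) - v (Sum.inr i.castSucc)) ^ 2}
      1 := by
  constructor
  · refine ⟨Sum.elim ![Real.sqrt (1/2), -Real.sqrt (1/2)] (fun _ => 0), ?_, ?_, ?_⟩
    · simp
    · have h : Real.sqrt (1/2) ^ 2 = 1/2 := Real.sq_sqrt (by norm_num)
      simp only [Sum.elim_inl, Matrix.cons_val_zero, Matrix.cons_val_one, neg_sq, h]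
      norm_num
    · have h : Real.sqrt (1/2) ^ 2 = 1/2 := Real.sq_sqrt (by norm_num)
      simp only [Sum.elim_inl, Sum.elim_inr, Matrix.cons_val_zero, Matrix.cons_val_one,
        sub_zero, neg_sq, h]
      norm_num
  · rintro E ⟨v, h0, h1, rfl⟩
    have hs : 0 ≤ ∑ i : Fin n, (v (Sum.inr i.succ) - v (Sum.inr i.castSucc)) ^ 2 :=
      Finset.sum_nonneg fun i _ => sq_nonneg _
    have hb : v (Sum.inl 1) = - v (Sum.inl 0) := by linarith
    rw [hb] at h1 ⊢
    nlinarith [sq_nonneg (v (Sum.inr 0))]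
end

section
/- Let Γ = (V, E) be a finite connected simple graph and B ⊆ V a boundary set with |B| ≥ 2 such that no edge of Γ joins two vertices of B, and let d_B denote the maximum graph distance in Γ between two vertices of B. Let μ : V × V → ℝ be a symmetric weight function with μ_{ij} > 0 whenever {i, j} ∈ E and μ_{ij} = 0 otherwise; set m_i = ∑_{j ∼ i} μ_{ij}, Vol(B) = ∑_{i∈B} m_i, and c = min{ μ_{ij} : {i, j} ∈ E }. Then every function v : V → ℝ satisfying ∑_{i∈B} v_i·m_i = 0 and ∑_{i∈B} v_i²·m_i = 1 has weighted Dirichlet energy ∑_{{i,j}∈E} μ_{ij}·(v_i − v_j)² ≥ c/(d_B·Vol(B)). Equivalently, the first nonzero eigenvalue of the Dirichlet-to-Neumann operator on the weighted graph (Γ, B, μ) satisfies σ₁ ≥ c/(d_B·Vol(B)). -/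
open Finset

theorem walk_sq_le {V : Type*} (G : SimpleGraph V) (v : V → ℝ) (F : Sym2 V → ℝ) (c : ℝ)
    (hc : 0 ≤ c) (hF : ∀ i j, G.Adj i j → c * (v i - v j) ^ 2 ≤ F s(i, j))
    {a b : V} (p : G.Walk a b) :
    0 ≤ (p.edges.map F).sum ∧ c * (v a - v b) ^ 2 ≤ p.length * (p.edges.map F).sum := by
  induction p with
  | nil => simp
  | @cons a d b h p ih =>
    obtain ⟨h0, h1⟩ := ih
    have h2 := hF _ _ h
    simp only [SimpleGraph.Walk.edges_cons, List.map_cons, List.sum_cons,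
      SimpleGraph.Walk.length_cons, Nat.cast_add, Nat.cast_one]
    set S := (p.edges.map F).sum
    have hx : 0 ≤ c * (v a - v d) ^ 2 := by positivity
    refine ⟨by linarith, ?_⟩
    have e : v a - v b = (v a - v d) + (v d - v b) := by ring
    rw [e]
    generalize v a - v d = x at *
    generalize v d - v b = y at *
    generalize F s(a, d) = f at *
    have hn : (0 : ℝ) ≤ p.length := Nat.cast_nonneg _
    rcases hn.eq_or_lt with hn | hn
    · rw [← hn] at h1 ⊢
      have hy : c * y ^ 2 = 0 := le_antisymm (by simpa using h1) (by positivity)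
      rcases mul_eq_zero.1 hy with hy | hy
      · subst hy; simp at *; linarith
      · have : y = 0 := by simpa using hy
        subst this; simp at *; linarith
    · generalize (p.length : ℝ) = n at *
      have k : 0 ≤ n * (n * f + S - 2 * c * x * y) := by
        have := mul_nonneg hc (sq_nonneg (n * x - y))
        have := mul_le_mul_of_nonneg_left h2 (sq_nonneg n)
        nlinarith
      have k' := nonneg_of_mul_nonneg_right k hn
      nlinarith

/-- **Weighted lower bound for σ₁ (Proposition, section 4).**
For a finite connected simple graph `G` with boundary `B` (no edge joins two
boundary vertices), a symmetric weight `μ` positive exactly on edges, vertex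
measure `m i = ∑_{j ∼ i} μ i j`, `Vol(B) = ∑_{i∈B} m i`, boundary diameter
`dB`, and `c = min{μ i j : {i,j} ∈ E}`, every `v : V → ℝ` with
`∑_{i∈B} v i · m i = 0` and `∑_{i∈B} (v i)² · m i = 1` has weighted Dirichlet
energy at least `c / (dB · Vol(B))`; equivalently `σ₁ ≥ c / (dB · Vol(B))`. -/
theorem steklov_weighted_lower_bound {V : Type*} [Fintype V] [DecidableEq V]
    (G : SimpleGraph V) [DecidableRel G.Adj] (hconn : G.Connected)
    (B : Finset V) (hB2 : 2 ≤ B.card)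
    (hBedge : ∀ i ∈ B, ∀ j ∈ B, ¬ G.Adj i j)
    (μ : V → V → ℝ) (hsym : ∀ i j, μ i j = μ j i)
    (hpos : ∀ i j, G.Adj i j → 0 < μ i j)
    (hzero : ∀ i j, ¬ G.Adj i j → μ i j = 0)
    (m : V → ℝ) (hm : ∀ i, m i = ∑ j ∈ G.neighborFinset i, μ i j)
    (Vol : ℝ) (hVol : Vol = ∑ i ∈ B, m i)
    (dB : ℕ) (hdB : dB = (B ×ˢ B).sup fun p => G.dist p.1 p.2)
    (c : ℝ) (hc : IsLeast {t : ℝ | ∃ i j, G.Adj i j ∧ μ i j = t} c)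
    (v : V → ℝ) (hsum : ∑ i ∈ B, v i * m i = 0)
    (hnorm : ∑ i ∈ B, (v i) ^ 2 * m i = 1) :
    c / (dB * Vol) ≤
      ∑ e ∈ G.edgeFinset,
        Sym2.lift ⟨fun i j => μ i j * (v i - v j) ^ 2,
          fun i j => by show μ i j * (v i - v j) ^ 2 = μ j i * (v j - v i) ^ 2; rw [hsym i j]; ring⟩ e := by
  set F : Sym2 V → ℝ := Sym2.lift ⟨fun i j => μ i j * (v i - v j) ^ 2,
          fun i j => by show μ i j * (v i - v j) ^ 2 = μ j i * (v j - v i) ^ 2; rw [hsym i j]; ring⟩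
    with hFdef
  have hFs : ∀ i j, F s(i, j) = μ i j * (v i - v j) ^ 2 := fun i j => rfl
  have hc0 : 0 < c := by
    obtain ⟨i, j, h, e⟩ := hc.1
    exact e ▸ hpos i j h
  have hF : ∀ i j, G.Adj i j → c * (v i - v j) ^ 2 ≤ F s(i, j) := by
    intro i j h
    rw [hFs]
    exact mul_le_mul_of_nonneg_right (hc.2 ⟨i, j, h, rfl⟩) (sq_nonneg _)
  have hF0 : ∀ e ∈ G.edgeFinset, 0 ≤ F e := by
    intro e
    induction e using Sym2.ind with
    | _ i j =>
      intro h
      have h' : G.Adj i j := by simpa using h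
      exact le_trans (by positivity) (hF i j h')
  have hm0 : ∀ i, 0 ≤ m i := by
    intro i
    rw [hm]
    exact Finset.sum_nonneg fun j hj => (hpos i j (by simpa using hj)).le
  have hV0 : 0 ≤ Vol := hVol ▸ Finset.sum_nonneg fun i _ => hm0 i
  have hBne : B.Nonempty := Finset.card_pos.1 (by omega)
  obtain ⟨a, ha, hamax⟩ := B.exists_max_image v hBne
  obtain ⟨b, hb, hbmin⟩ := B.exists_min_image v hBne
  have key : 1 ≤ -(v a * v b) * Vol := by
    have h : 0 ≤ ∑ i ∈ B, (v a - v i) * (v i - v b) * m i :=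
      Finset.sum_nonneg fun i hi => mul_nonneg (mul_nonneg (sub_nonneg.2 (hamax i hi))
        (sub_nonneg.2 (hbmin i hi))) (hm0 i)
    have e : ∑ i ∈ B, (v a - v i) * (v i - v b) * m i
        = (v a + v b) * ∑ i ∈ B, v i * m i - ∑ i ∈ B, (v i) ^ 2 * m i
          - v a * v b * ∑ i ∈ B, m i := by
      rw [Finset.mul_sum, Finset.mul_sum, ← Finset.sum_sub_distrib, ← Finset.sum_sub_distrib]
      exact Finset.sum_congr rfl fun i _ => by ring
    rw [e, hsum, hnorm, ← hVol] at h
    linarith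
  have key2 : 1 ≤ (v a - v b) ^ 2 * Vol := by
    have h1 : -(v a * v b) ≤ (v a - v b) ^ 2 := by
      nlinarith [sq_nonneg (v a - v b), sq_nonneg (v a + v b)]
    exact key.trans (mul_le_mul_of_nonneg_right h1 hV0)
  obtain ⟨p, hp, hlen⟩ := hconn.exists_path_of_dist a b
  obtain ⟨w0, w1⟩ := walk_sq_le G v F c hc0.le hF p
  have hE : (p.edges.map F).sum ≤ ∑ e ∈ G.edgeFinset, F e := by
    rw [← List.sum_toFinset F hp.isTrail.edges_nodup]
    refine Finset.sum_le_sum_of_subset_of_nonneg ?_ fun e he _ => hF0 e he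
    intro e he
    rw [List.mem_toFinset] at he
    exact SimpleGraph.mem_edgeFinset.2 (p.edges_subset_edgeSet he)
  have hd : (p.length : ℝ) ≤ dB := by
    have : G.dist a b ≤ dB := by
      rw [hdB]
      exact Finset.le_sup (f := fun p : V × V => G.dist p.1 p.2) (b := (a, b))
        (Finset.mem_product.2 ⟨ha, hb⟩)
    rw [hlen]
    exact_mod_cast this
  have hfin : c * (v a - v b) ^ 2 ≤ dB * ∑ e ∈ G.edgeFinset, F e :=
    w1.trans (mul_le_mul hd hE w0 (Nat.cast_nonneg _))
  refine div_le_of_le_mul₀ (by positivity) (Finset.sum_nonneg hF0) ?_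
  calc c = c * 1 := by ring
    _ ≤ c * ((v a - v b) ^ 2 * Vol) := mul_le_mul_of_nonneg_left key2 hc0.le
    _ = c * (v a - v b) ^ 2 * Vol := by ring
    _ ≤ (dB * ∑ e ∈ G.edgeFinset, F e) * Vol := mul_le_mul_of_nonneg_right hfin hV0
    _ = _ := by ring
end
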